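/- Let n ≥ 1, let U ⊆ ℝⁿ be an open set with ℝ^{>0}·U ⊆ U, let k > 1 be real, let h : U → ℝ be smooth, positive, and positively homogeneous of degree k, assume that for every x ∈ U the restriction of −(D²h)ₓ to ker((Dh)ₓ) is positive definite, and let c < 0. Then for every x ∈ U_c = {x ∈ U : h(x) + c > 0} and every v ∈ ℝⁿ: g'_c(x)(v, v) − g'(x)(v, v) ≥ (1/k)·(1/(h(x)+c)² − 1/h(x)²)·((Dh)ₓ(v))² ≥ 0, where g'(x) = −(D²(log h))ₓ and g'_c(x) = −(D²(log(h+c)))ₓ. -/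

import Mathlib

noncomputable section

/-- The second derivative of `f` at `x`, as a bilinear form: `(D²f)ₓ(u, v)`. -/
def D2 {n : ℕ} (f : (Fin n → ℝ) → ℝ) (x u v : Fin n → ℝ) : ℝ :=
  fderiv ℝ (fderiv ℝ f) x u v

/-- The symmetric bilinear form `g_U(x) = −(D²h)ₓ`. -/
def gU {n : ℕ} (h : (Fin n → ℝ) → ℝ) (x u v : Fin n → ℝ) : ℝ := -D2 h x u v

/-- The symmetric bilinear form `g'(x) = −(D²(log h))ₓ`. -/
def gprime {n : ℕ} (h : (Fin n → ℝ) → ℝ) (x u v : Fin n → ℝ) : ℝ :=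
  -D2 (fun y => Real.log (h y)) x u v

/-- The symmetric bilinear form `g'_c(x) = −(D²(log(h+c)))ₓ`. -/
def gprimec {n : ℕ} (h : (Fin n → ℝ) → ℝ) (c : ℝ) (x u v : Fin n → ℝ) : ℝ :=
  -D2 (fun y => Real.log (h y + c)) x u v

/-- **Euler's identity** for positively homogeneous functions. -/
theorem fderiv_apply_self_of_homogeneous {n : ℕ} {h : (Fin n → ℝ) → ℝ} {k : ℝ}
    {x : Fin n → ℝ} (hd : DifferentiableAt ℝ h x)
    (hhom : ∀ l : ℝ, 0 < l → h (l • x) = l ^ k * h x) :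
    fderiv ℝ h x x = k * h x := by
  have hray : HasDerivAt (fun l : ℝ => l • x) x 1 := by
    simpa using (hasDerivAt_id (1 : ℝ)).smul_const x
  have hcomp : HasDerivAt (fun l : ℝ => h (l • x)) (fderiv ℝ h x x) 1 := by
    have hd' : HasFDerivAt h (fderiv ℝ h x) ((1 : ℝ) • x) := by
      simpa using hd.hasFDerivAt
    exact hd'.comp_hasDerivAt 1 hray
  have hpow : HasDerivAt (fun l : ℝ => l ^ k * h x) (k * h x) 1 := by
    simpa using (Real.hasDerivAt_rpow_const (x := 1) (p := k) (Or.inl one_ne_zero)).mul_const (h x)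
  refine hcomp.unique (hpow.congr_of_eventuallyEq ?_)
  filter_upwards [lt_mem_nhds (zero_lt_one' ℝ)] with l hl using hhom l hl

/-- Differentiating Euler's identity. -/
theorem D2_apply_self_of_euler {n : ℕ} {h : (Fin n → ℝ) → ℝ} {k : ℝ} {x : Fin n → ℝ}
    (hd : DifferentiableAt ℝ h x) (hd2 : DifferentiableAt ℝ (fderiv ℝ h) x)
    (heuler : ∀ᶠ y in nhds x, fderiv ℝ h y y = k * h y) (u : Fin n → ℝ) :
    D2 h x u x = (k - 1) * fderiv ℝ h x u := by
  have hl := hd2.hasFDerivAt.clm_apply (hasFDerivAt_id x)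
  have hr := (hd.hasFDerivAt.const_mul k).congr_of_eventuallyEq heuler
  have := congrArg (fun L => L u) (hl.unique hr)
  simp at this
  unfold D2
  linarith

/-- The Hessian of `log (h + c)`. -/
theorem D2_log_add_const {n : ℕ} {h : (Fin n → ℝ) → ℝ} {c : ℝ} {x : Fin n → ℝ}
    (hd : ∀ᶠ y in nhds x, DifferentiableAt ℝ h y)
    (hd2 : DifferentiableAt ℝ (fderiv ℝ h) x) (hx : 0 < h x + c) (u v : Fin n → ℝ) :
    D2 (fun y => Real.log (h y + c)) x u v =
      D2 h x u v / (h x + c) - fderiv ℝ h x u * fderiv ℝ h x v / (h x + c) ^ 2 := by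
  have hdx : HasFDerivAt (fun y => h y + c) (fderiv ℝ h x) x :=
    hd.self_of_nhds.hasFDerivAt.add_const c
  have hfirst : fderiv ℝ (fun y => Real.log (h y + c)) =ᶠ[nhds x]
      fun y => (h y + c)⁻¹ • fderiv ℝ h y := by
    filter_upwards [hd, hdx.continuousAt.eventually (lt_mem_nhds hx)] with y hy hy0
    exact ((hy.hasFDerivAt.add_const c).log hy0.ne').fderiv
  have hinv : HasFDerivAt (fun y => (h y + c)⁻¹) (-((h x + c) ^ 2)⁻¹ • fderiv ℝ h x) x :=
    (hasDerivAt_inv hx.ne').comp_hasFDerivAt x hdx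
  have hsecond := hinv.smul hd2.hasFDerivAt
  unfold D2
  rw [hfirst.fderiv_eq]
  erw [hsecond.fderiv]
  simp
  ring

/-- If the Hessian of a degree `k` homogeneous function is nonpositive on `ker Dh`, it is bounded
above by its value in the radial direction. -/
theorem D2_le_of_homogeneous {n : ℕ} {h : (Fin n → ℝ) → ℝ} {k : ℝ} {x : Fin n → ℝ}
    (hk : 0 < k) (hx : 0 < h x) (heuler : fderiv ℝ h x x = k * h x)
    (hrad : ∀ u, D2 h x u x = (k - 1) * fderiv ℝ h x u)
    (hsymm : ∀ u v, D2 h x u v = D2 h x v u)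
    (hker : ∀ w, fderiv ℝ h x w = 0 → D2 h x w w ≤ 0) (v : Fin n → ℝ) :
    D2 h x v v ≤ (k - 1) / (k * h x) * fderiv ℝ h x v ^ 2 := by
  have hkh : k * h x ≠ 0 := by positivity
  set s := fderiv ℝ h x v / (k * h x) with hs
  have hsv : fderiv ℝ h x v = s * (k * h x) := by rw [hs]; field_simp
  have hw : fderiv ℝ h x (v - s • x) = 0 := by
    simp [heuler, hsv]
  have hexp : D2 h x (v - s • x) (v - s • x) =
      D2 h x v v - s * D2 h x v x - s * D2 h x x v + s ^ 2 * D2 h x x x := by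
    simp [D2]
    ring
  have hle := hker _ hw
  rw [hexp, hsymm x v, hrad, hrad, heuler, hsv] at hle
  have : (k - 1) / (k * h x) * fderiv ℝ h x v ^ 2 = (k - 1) * s ^ 2 * (k * h x) := by
    rw [hsv]; field_simp
  rw [this]
  linarith

/-- Let `h` be smooth, positive and positively homogeneous of degree `k > 1` on an
open cone `U ⊆ ℝⁿ`, with `−D²h` positive definite on `ker Dh`, and let `c < 0`.  Then
for every `x ∈ U_c = {x ∈ U : h(x) + c > 0}` and every `v`:
`g'_c(x)(v,v) − g'(x)(v,v) ≥ (1/k)·(1/(h(x)+c)² − 1/h(x)²)·((Dh)ₓ(v))² ≥ 0`. -/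
theorem stmt16 {n : ℕ} (hn : 1 ≤ n)
    (U : Set (Fin n → ℝ)) (hU : IsOpen U)
    (hcone : ∀ l : ℝ, 0 < l → ∀ x ∈ U, l • x ∈ U)
    (k : ℝ) (hk : 1 < k)
    (h : (Fin n → ℝ) → ℝ) (hsm : ContDiffOn ℝ (⊤ : ℕ∞) h U)
    (hpos : ∀ x ∈ U, 0 < h x)
    (hhom : ∀ l : ℝ, 0 < l → ∀ x ∈ U, h (l • x) = l ^ k * h x)
    (hker : ∀ x ∈ U, ∀ v : Fin n → ℝ, fderiv ℝ h x v = 0 → v ≠ 0 → 0 < gU h x v v)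
    (c : ℝ) (hc : c < 0) :
    ∀ x ∈ {x ∈ U | 0 < h x + c}, ∀ v : Fin n → ℝ,
      (1 / k) * (1 / (h x + c) ^ 2 - 1 / (h x) ^ 2) * (fderiv ℝ h x v) ^ 2
          ≤ gprimec h c x v v - gprime h x v v ∧
      0 ≤ (1 / k) * (1 / (h x + c) ^ 2 - 1 / (h x) ^ 2) * (fderiv ℝ h x v) ^ 2 := by
  rintro x ⟨hxU, hxc⟩ v
  have hx := hpos x hxU
  have hk0 : 0 < k := by linarith
  have hsmx : ∀ y ∈ U, ContDiffAt ℝ (⊤ : ℕ∞) h y := fun y hy => hsm.contDiffAt (hU.mem_nhds hy)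
  have hd : ∀ y ∈ U, DifferentiableAt ℝ h y := fun y hy => (hsmx y hy).differentiableAt (by simp)
  have hd2 : DifferentiableAt ℝ (fderiv ℝ h) x :=
    ((hsmx x hxU).fderiv_right (m := 1) (by norm_cast)).differentiableAt (by simp)
  have heuler : ∀ y ∈ U, fderiv ℝ h y y = k * h y := fun y hy =>
    fderiv_apply_self_of_homogeneous (hd y hy) fun l hl => hhom l hl y hy
  have hUx : ∀ᶠ y in nhds x, y ∈ U := hU.mem_nhds hxU
  have hsymm : ∀ u w, D2 h x u w = D2 h x w u := fun u w =>
    ((hsmx x hxU).isSymmSndFDerivAt (by simp; norm_cast)).eq u w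
  have hbound : D2 h x v v ≤ (k - 1) / (k * h x) * fderiv ℝ h x v ^ 2 := by
    refine D2_le_of_homogeneous hk0 hx (heuler x hxU)
      (D2_apply_self_of_euler (hd x hxU) hd2 (hUx.mono heuler)) hsymm (fun w hw => ?_) v
    rcases eq_or_ne w 0 with rfl | hw0
    · simp [D2]
    · have := hker x hxU w hw hw0
      unfold gU at this
      linarith
  have hlogc := D2_log_add_const (c := c) (hUx.mono hd) hd2 hxc v v
  have hlog := D2_log_add_const (c := 0) (hUx.mono hd) hd2 (by simpa using hx) v v
  simp only [add_zero] at hlog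
  unfold gprimec gprime
  rw [hlogc, hlog]
  have hinv : 1 / h x ≤ 1 / (h x + c) := one_div_le_one_div_of_le hxc (by linarith)
  have hinv0 : 0 < 1 / h x := by positivity
  set p := 1 / (h x + c) with hp
  set q := 1 / h x with hq
  set d := fderiv ℝ h x v
  set B := D2 h x v v
  have hp2 : 1 / (h x + c) ^ 2 = p ^ 2 := by rw [hp, one_div_pow]
  have hq2 : 1 / h x ^ 2 = q ^ 2 := by rw [hq, one_div_pow]
  have hk1 : 1 / k ≤ 1 := by rw [div_le_one hk0]; exact hk.le
  have hB : B ≤ (1 - 1 / k) * q * d ^ 2 := by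
    refine hbound.trans_eq ?_
    rw [hq]
    field_simp
  rw [hp2, hq2]
  constructor
  · have hdiff : -(B / (h x + c) - d * d / (h x + c) ^ 2) - -(B / h x - d * d / h x ^ 2) =
        -(B * (p - q)) + d ^ 2 * (p ^ 2 - q ^ 2) := by
      rw [← hp2, ← hq2, hp, hq]
      ring
    rw [hdiff]
    have hmul := mul_le_mul_of_nonneg_right hB (sub_nonneg.2 hinv)
    have hrest : 0 ≤ (1 - 1 / k) * d ^ 2 * ((p - q) * p) :=
      mul_nonneg (mul_nonneg (sub_nonneg.2 hk1) (sq_nonneg d))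
        (mul_nonneg (sub_nonneg.2 hinv) (hinv0.le.trans hinv))
    linear_combination hmul + hrest
  · have : 0 ≤ p ^ 2 - q ^ 2 := sub_nonneg.2 (pow_le_pow_left₀ hinv0.le hinv 2)
    positivity
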